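/- Let E ⊆ ℕA be the exponent set of a monomial ideal. Then E has only finitely many standard pairs. -/

import Mathlib

open scoped BigOperators

namespace StdPairsPaper

/-- The coercion of a lattice point to a real vector. -/
def toR {d : ℕ} (v : Fin d → ℤ) : Fin d → ℝ := fun i => (v i : ℝ)

/-- The cone of nonnegative real combinations of (the real images of) elements of `S`. -/
def cone {d : ℕ} (S : Set (Fin d → ℤ)) : Set (Fin d → ℝ) :=
  {x | ∃ (t : Finset (Fin d → ℤ)) (c : (Fin d → ℤ) → ℝ),
    (t : Set (Fin d → ℤ)) ⊆ S ∧ (∀ v, 0 ≤ c v) ∧ x = ∑ v ∈ t, c v • toR v}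

/-- `ℕS`, the submonoid of `ℤ^d` generated by `S`. -/
def NSemi {d : ℕ} (S : Set (Fin d → ℤ)) : AddSubmonoid (Fin d → ℤ) :=
  AddSubmonoid.closure S

/-- `ℤS`, the subgroup of `ℤ^d` generated by `S`. -/
def ZGrp {d : ℕ} (S : Set (Fin d → ℤ)) : AddSubgroup (Fin d → ℤ) :=
  AddSubgroup.closure S

/-- `ℝS`, the real linear span of `S`. -/
def RSpan {d : ℕ} (S : Set (Fin d → ℤ)) : Submodule ℝ (Fin d → ℝ) :=
  Submodule.span ℝ (toR '' S)

/-- `A` is a configuration: a finite set of nonzero lattice points whose `ℤ`-span is `ℤ^d`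
and whose nonnegative real cone is strongly convex (contains no line, i.e. is pointed). -/
structure IsConfig {d : ℕ} (A : Set (Fin d → ℤ)) : Prop where
  (finite : A.Finite)
  (nonzero : (0 : Fin d → ℤ) ∉ A)
  (spans : ZGrp A = ⊤)
  (pointed : ∀ x ∈ cone A, -x ∈ cone A → x = 0)

/-- `F` is a face of the configuration `A`: `F ⊆ A`, the cone over `F` is an extreme
subset (face) of the cone over `A`, and `ℝ_{≥0}F ∩ A = F`. -/
def IsFace {d : ℕ} (A F : Set (Fin d → ℤ)) : Prop :=
  F ⊆ A ∧ IsExtreme ℝ (cone A) (cone F) ∧ cone F ∩ (toR '' A) = toR '' F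

/-- The set `a + ℕF`. -/
def cell {d : ℕ} (a : Fin d → ℤ) (F : Set (Fin d → ℤ)) : Set (Fin d → ℤ) :=
  {x | ∃ f ∈ NSemi F, x = a + f}

/-- Two pairs `(a,F)` and `(b,F)` belonging to the same face `F` overlap: `a - b ∈ ℤF`. -/
def Overlap {d : ℕ} (F : Set (Fin d → ℤ)) (a b : Fin d → ℤ) : Prop :=
  a - b ∈ ZGrp F

/-- The pair `(a,F)` divides the pair `(b,G)`:
there is `c ∈ ℕA` with `a + c + ℕF ⊆ b + ℕG`. -/
def PairDvd {d : ℕ} (A : Set (Fin d → ℤ)) (a : Fin d → ℤ) (F : Set (Fin d → ℤ))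
    (b : Fin d → ℤ) (G : Set (Fin d → ℤ)) : Prop :=
  ∃ c ∈ NSemi A, cell (a + c) F ⊆ cell b G

/-- `E` is the exponent set of a monomial ideal of `ℕA`: `E ⊆ ℕA` and `E + ℕA ⊆ E`. -/
def IsExpSet {d : ℕ} (A E : Set (Fin d → ℤ)) : Prop :=
  E ⊆ (NSemi A : Set (Fin d → ℤ)) ∧ ∀ e ∈ E, ∀ c ∈ NSemi A, e + c ∈ E

/-- The standard monomials of `E`: `ℕA ∖ E`. -/
def stdSet {d : ℕ} (A E : Set (Fin d → ℤ)) : Set (Fin d → ℤ) :=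
  (NSemi A : Set (Fin d → ℤ)) \ E

/-- `(a,F)` is a proper pair of `E`: a pair of `A` with `a + ℕF ⊆ std(E)`. -/
def ProperPair {d : ℕ} (A E : Set (Fin d → ℤ)) (a : Fin d → ℤ)
    (F : Set (Fin d → ℤ)) : Prop :=
  a ∈ NSemi A ∧ IsFace A F ∧ cell a F ⊆ stdSet A E

/-- `(a,F)` is a standard pair of `E`: a proper pair of `E` maximal with respect to
the partial order `(a,F) ≼ (b,G) ↔ a + ℕF ⊆ b + ℕG`. -/
def StdPair {d : ℕ} (A E : Set (Fin d → ℤ)) (a : Fin d → ℤ)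
    (F : Set (Fin d → ℤ)) : Prop :=
  ProperPair A E a F ∧
    ∀ b G, ProperPair A E b G → cell a F ⊆ cell b G → cell b G ⊆ cell a F

/-- The overlap class of the standard pair `(a,F)` of `E` is maximal with respect to
divisibility among overlap classes of standard pairs of `E`. -/
def MaxClass {d : ℕ} (A E : Set (Fin d → ℤ)) (a : Fin d → ℤ)
    (F : Set (Fin d → ℤ)) : Prop :=
  ∀ b G, StdPair A E b G → PairDvd A a F b G → PairDvd A b G a F

noncomputable section

/-- The affine semigroup ring `k[ℕA]`. -/
abbrev SGRing {d : ℕ} (k : Type*) [Field k] (A : Set (Fin d → ℤ)) :=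
  AddMonoidAlgebra k (NSemi A)

/-- The monomial `t^a` of `k[ℕA]`. -/
def mono {d : ℕ} (k : Type*) [Field k] (A : Set (Fin d → ℤ)) (a : (NSemi A)) :
    SGRing k A :=
  AddMonoidAlgebra.single a 1

/-- `I` is a monomial ideal of `k[ℕA]`: an ideal generated by monomials. -/
def IsMonomialIdeal {d : ℕ} (k : Type*) [Field k] (A : Set (Fin d → ℤ))
    (I : Ideal (SGRing k A)) : Prop :=
  ∃ S : Set (NSemi A), I = Ideal.span ((fun a => mono k A a) '' S)

/-- The exponent set `E(I) = {a ∈ ℕA : t^a ∈ I}` of an ideal of `k[ℕA]`,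
as a subset of `ℤ^d`. -/
def expSet {d : ℕ} (k : Type*) [Field k] (A : Set (Fin d → ℤ))
    (I : Ideal (SGRing k A)) : Set (Fin d → ℤ) :=
  {x | ∃ h : x ∈ NSemi A, mono k A ⟨x, h⟩ ∈ I}

/-- The monomial prime ideal `p_F = ⟨t^a : a ∈ ℕA ∖ ℕF⟩` of `k[ℕA]`. -/
def primeF {d : ℕ} (k : Type*) [Field k] (A F : Set (Fin d → ℤ)) :
    Ideal (SGRing k A) :=
  Ideal.span {x | ∃ a : (NSemi A), (a : Fin d → ℤ) ∉ NSemi F ∧ x = mono k A a}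

end


/-- Finitely many positive reals can be sent simultaneously to positive integers by an additive
map `ℝ → ℚ`. -/
theorem exists_addMonoidHom_pos (s : Finset ℝ) (hs : ∀ x ∈ s, 0 < x) :
    ∃ ψ : ℝ →+ ℚ, ∀ x ∈ s, ∃ n : ℕ, 0 < n ∧ ψ x = n := by
  let B := Module.Basis.ofVectorSpace ℚ ℝ
  let L : ℝ → (Module.Basis.ofVectorSpaceIndex ℚ ℝ → ℝ) → ℝ :=
    fun x β => ∑ i ∈ (B.repr x).support, (B.repr x i : ℝ) * β i
  have hLB : ∀ x, L x B = x := by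
    intro x
    conv_rhs => rw [← B.linearCombination_repr x, Finsupp.linearCombination_apply]
    simp [L, Finsupp.sum, Rat.smul_def]
  have hopen : IsOpen {β | ∀ x ∈ s, 0 < L x β} := by
    have : {β | ∀ x ∈ s, 0 < L x β} = ⋂ x ∈ s, {β | 0 < L x β} := by ext; simp
    rw [this]
    refine isOpen_biInter_finset fun x _ => isOpen_lt continuous_const ?_
    fun_prop
  have hdense : DenseRange
      (Pi.map fun (_ : Module.Basis.ofVectorSpaceIndex ℚ ℝ) (q : ℚ) => (q : ℝ)) :=
    DenseRange.piMap fun _ => Rat.denseRange_cast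
  obtain ⟨β, hβ⟩ := hdense.exists_mem_open hopen ⟨B, fun x hx => by rw [hLB]; exact hs x hx⟩
  let φ : ℝ →ₗ[ℚ] ℚ := B.constr ℚ β
  have hφ : ∀ x ∈ s, 0 < φ x := by
    intro x hx
    have h1 : ((φ x : ℚ) : ℝ) = L x (Pi.map (fun _ (q : ℚ) => (q : ℝ)) β) := by
      simp [φ, L, Module.Basis.constr_apply, Finsupp.sum]
    have h2 := hβ x hx
    rw [← h1] at h2
    exact_mod_cast h2
  let D : ℕ := ∏ x ∈ s, (φ x).den
  have hD : 0 < D := Finset.prod_pos fun x _ => (φ x).den_pos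
  refine ⟨((D : ℚ) • φ).toAddMonoidHom, fun x hx => ?_⟩
  obtain ⟨k, hk⟩ : (φ x).den ∣ D := Finset.dvd_prod_of_mem (fun x => (φ x).den) hx
  have hnum : 0 < (φ x).num := Rat.num_pos.2 (hφ x hx)
  have hk0 : 0 < k := Nat.pos_of_ne_zero fun h => by simp [h] at hk; omega
  refine ⟨k * (φ x).num.toNat, Nat.mul_pos hk0 (by omega), ?_⟩
  have h3 : (((φ x).num.toNat : ℕ) : ℚ) = (φ x).num := by
    exact_mod_cast Int.toNat_of_nonneg hnum.le
  have h4 : (φ x).den * φ x = (φ x).num := Rat.den_mul_eq_num (φ x)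
  change (D : ℚ) * φ x = _
  rw [hk]
  push_cast
  rw [h3, ← h4]
  ring

section Cone

variable {d : ℕ} {A F : Set (Fin d → ℤ)}

theorem toR_injective : Function.Injective (toR : (Fin d → ℤ) → Fin d → ℝ) := by
  intro v w h
  funext i
  exact Int.cast_injective (congrFun h i)

/-- `toR` as an additive map. -/
def toRHom (d : ℕ) : (Fin d → ℤ) →+ (Fin d → ℝ) where
  toFun := toR
  map_zero' := by funext i; simp [toR]
  map_add' v w := by funext i; simp [toR]

theorem mem_cone_iff (hA : A.Finite) {x : Fin d → ℝ} :
    x ∈ cone A ↔ ∃ c : (Fin d → ℤ) → ℝ, (∀ v, 0 ≤ c v) ∧ x = ∑ v ∈ hA.toFinset, c v • toR v := by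
  classical
  constructor
  · rintro ⟨t, c, ht, hc, rfl⟩
    refine ⟨fun v => if v ∈ t then c v else 0, fun v => ?_, ?_⟩
    · dsimp only
      split_ifs
      exacts [hc v, le_rfl]
    · have hsub : t ⊆ hA.toFinset := fun v hv => hA.mem_toFinset.2 (ht hv)
      simp only [ite_smul, zero_smul]
      rw [Finset.sum_ite_mem, Finset.inter_eq_right.2 hsub]
  · rintro ⟨c, hc, rfl⟩
    exact ⟨hA.toFinset, c, by simp, hc, rfl⟩

theorem toR_mem_cone {v : Fin d → ℤ} (hv : v ∈ A) : toR v ∈ cone A :=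
  ⟨{v}, fun _ => 1, by simpa using hv, fun _ => zero_le_one, by simp⟩

theorem cone_mono (h : F ⊆ A) : cone F ⊆ cone A := by
  rintro x ⟨t, c, ht, hc, rfl⟩
  exact ⟨t, c, ht.trans h, hc, rfl⟩

theorem smul_mem_cone {r : ℝ} (hr : 0 ≤ r) {x : Fin d → ℝ} (hx : x ∈ cone A) :
    r • x ∈ cone A := by
  obtain ⟨t, c, ht, hc, rfl⟩ := hx
  exact ⟨t, fun v => r * c v, ht, fun v => mul_nonneg hr (hc v), by
    simp [Finset.smul_sum, mul_smul]⟩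

/-- The cone of a finite set, as an additive submonoid. -/
def coneSubmonoid (hA : A.Finite) : AddSubmonoid (Fin d → ℝ) where
  carrier := cone A
  zero_mem' := ⟨∅, 0, by simp, fun _ => le_rfl, by simp⟩
  add_mem' {x y} hx hy := by
    obtain ⟨c, hc, rfl⟩ := (mem_cone_iff hA).1 hx
    obtain ⟨e, he, rfl⟩ := (mem_cone_iff hA).1 hy
    exact (mem_cone_iff hA).2 ⟨fun v => c v + e v, fun v => add_nonneg (hc v) (he v), by
      simp [add_smul, Finset.sum_add_distrib]⟩

theorem toR_mem_cone_of_mem_NSemi (hA : A.Finite) {v : Fin d → ℤ} (hv : v ∈ NSemi A) :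
    toR v ∈ cone A := by
  have : NSemi A ≤ (coneSubmonoid hA).comap (toRHom d) :=
    AddSubmonoid.closure_le.2 fun v hv => toR_mem_cone hv
  exact this hv

/-- A lattice point `g` of `ℕA` which is dominated by a real multiple of `p` with respect to the
cone order is dominated by an integer multiple of `p` with respect to `ℕA`. -/
theorem exists_nsmul_sub_mem_NSemi (hA : A.Finite) {p g : Fin d → ℤ} (hp : p ∈ NSemi A)
    (hg : g ∈ NSemi A) {r : ℝ} (h : r • toR p - toR g ∈ cone A) :
    ∃ N : ℕ, N • p - g ∈ NSemi A := by
  classical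
  wlog hr : 0 < r generalizing r
  · refine this (r := 1) ?_ one_pos
    have := (coneSubmonoid hA).add_mem h
      (smul_mem_cone (r := 1 - r) (by linarith) (toR_mem_cone_of_mem_NSemi hA hp))
    have heq : (1 : ℝ) • toR p - toR g = r • toR p - toR g + (1 - r) • toR p := by module
    rw [heq]
    exact this
  obtain ⟨c, hc, hsum⟩ := (mem_cone_iff hA).1 h
  obtain ⟨ψ, hψ⟩ := exists_addMonoidHom_pos
    (insert r (insert 1 ((hA.toFinset.image c).filter (0 < ·)))) (by
      intro x hx
      simp only [Finset.mem_insert, Finset.mem_filter] at hx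
      rcases hx with rfl | rfl | hx
      exacts [hr, one_pos, hx.2])
  obtain ⟨m, -, hm⟩ := hψ r (by simp)
  obtain ⟨k, hk0, hk⟩ := hψ 1 (by simp)
  have hn : ∀ v : Fin d → ℤ, ∃ n : ℕ, v ∈ A → ψ (c v) = n := by
    intro v
    by_cases hv : v ∈ A
    · rcases (hc v).eq_or_lt with h0 | h0
      · exact ⟨0, fun _ => by simp [← h0]⟩
      · obtain ⟨n, -, hn⟩ := hψ (c v) (by
          simp only [Finset.mem_insert, Finset.mem_filter, Finset.mem_image]
          exact Or.inr (Or.inr ⟨⟨v, hA.mem_toFinset.2 hv, rfl⟩, h0⟩))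
        exact ⟨n, fun _ => hn⟩
    · exact ⟨0, fun h => absurd h hv⟩
  choose n hn using hn
  have hψmul : ∀ (x : ℝ) (z : ℤ), ψ (x * z) = ψ x * z := by
    intro x z
    rw [mul_comm, ← zsmul_eq_mul, map_zsmul, zsmul_eq_mul, mul_comm]
  have key : m • p - k • g = ∑ v ∈ hA.toFinset, n v • v := by
    funext j
    have h1 := congrArg ψ (congrFun hsum j)
    simp only [Pi.sub_apply, Pi.smul_apply, Finset.sum_apply, smul_eq_mul, toR, map_sub,
      map_sum, hψmul] at h1
    have h2 : ψ (g j : ℝ) = k * g j := by rw [← hk, ← hψmul, one_mul]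
    rw [h2, hm, Finset.sum_congr rfl fun v hv => by rw [hn v (hA.mem_toFinset.1 hv)]] at h1
    simp only [Pi.sub_apply, Finset.sum_apply, nsmul_eq_mul]
    exact_mod_cast h1
  refine ⟨m, ?_⟩
  obtain ⟨k, rfl⟩ := Nat.exists_eq_add_of_lt hk0
  have : m • p - g = (∑ v ∈ hA.toFinset, n v • v) + k • g := by
    rw [← key, zero_add, add_smul, one_smul]
    abel
  rw [this]
  exact add_mem (sum_mem fun v hv => nsmul_mem
    (AddSubmonoid.subset_closure (hA.mem_toFinset.1 hv)) _) (nsmul_mem hg _)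

/-- The elements of `A` dominated by a multiple of `p`: the smallest face containing `p`. -/
def faceOf (A : Set (Fin d → ℤ)) (p : Fin d → ℤ) : Set (Fin d → ℤ) :=
  {g ∈ A | ∃ N : ℕ, N • p - g ∈ NSemi A}

theorem faceOf_subset (A : Set (Fin d → ℤ)) (p : Fin d → ℤ) : faceOf A p ⊆ A := fun _ h => h.1

theorem exists_smul_sub_mem_cone (hA : A.Finite) {p : Fin d → ℤ} {z : Fin d → ℝ}
    (hz : z ∈ cone (faceOf A p)) : ∃ r : ℝ, r • toR p - z ∈ cone A := by
  obtain ⟨t, c, ht, hc, rfl⟩ := hz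
  have hN : ∀ v : Fin d → ℤ, ∃ N : ℕ, v ∈ t → N • p - v ∈ NSemi A := by
    intro v
    by_cases hv : v ∈ t
    · obtain ⟨N, hN⟩ := (ht hv).2
      exact ⟨N, fun _ => hN⟩
    · exact ⟨0, fun h => absurd h hv⟩
  choose N hN using hN
  refine ⟨∑ v ∈ t, c v * N v, ?_⟩
  have : (∑ v ∈ t, c v * N v) • toR p - ∑ v ∈ t, c v • toR v
      = ∑ v ∈ t, c v • toR (N v • p - v) := by
    rw [Finset.sum_smul, ← Finset.sum_sub_distrib]
    refine Finset.sum_congr rfl fun v _ => ?_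
    have : toR (N v • p - v) = (N v : ℝ) • toR p - toR v := by
      funext j
      simp [toR]
    rw [this, smul_sub, smul_smul]
  rw [this]
  exact (coneSubmonoid hA).sum_mem fun v hv =>
    smul_mem_cone (hc v) (toR_mem_cone_of_mem_NSemi hA (hN v hv))

theorem isFace_faceOf (hA : A.Finite) {p : Fin d → ℤ} (hp : p ∈ NSemi A) :
    IsFace A (faceOf A p) := by
  classical
  refine ⟨faceOf_subset A p, ⟨cone_mono (faceOf_subset A p), ?_⟩, ?_⟩
  · rintro x hx y hy z hz ⟨α, β, hα, hβ, -, rfl⟩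
    obtain ⟨r, hr⟩ := exists_smul_sub_mem_cone hA hz
    obtain ⟨c, hc, rfl⟩ := (mem_cone_iff hA).1 hx
    refine ⟨hA.toFinset.filter (0 < c ·), c, ?_, hc, ?_⟩
    · intro v hv
      obtain ⟨hvA, hv0⟩ := Finset.mem_filter.1 hv
      rw [hA.mem_toFinset] at hvA
      refine ⟨hvA, ?_⟩
      refine exists_nsmul_sub_mem_NSemi hA hp (AddSubmonoid.subset_closure hvA)
        (r := (α * c v)⁻¹ * r) ?_
      have hrest : ∑ w ∈ hA.toFinset.erase v, c w • toR w ∈ cone A :=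
        (coneSubmonoid hA).sum_mem fun w hw => smul_mem_cone (hc w)
          (toR_mem_cone (hA.mem_toFinset.1 (Finset.mem_of_mem_erase hw)))
      have h1 := (coneSubmonoid hA).add_mem hr ((coneSubmonoid hA).add_mem
        (smul_mem_cone hβ.le hy) (smul_mem_cone hα.le hrest))
      have h2 := smul_mem_cone (r := (α * c v)⁻¹) (by positivity) h1
      convert h2 using 1
      rw [← Finset.add_sum_erase _ _ (hA.mem_toFinset.2 hvA)]
      have h3 : (α * c v)⁻¹ • (α • c v • toR v) = toR v := by
        rw [smul_smul α, inv_smul_smul₀ (by positivity)]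
      nth_rw 1 [← h3]
      module
    · rw [Finset.sum_filter]
      refine Finset.sum_congr rfl fun v _ => ?_
      split_ifs with h
      · rfl
      · rw [le_antisymm (not_lt.1 h) (hc v), zero_smul]
  · apply Set.Subset.antisymm
    · rintro _ ⟨hx, a, ha, rfl⟩
      obtain ⟨r, hr⟩ := exists_smul_sub_mem_cone hA hx
      exact ⟨a, ⟨ha, exists_nsmul_sub_mem_NSemi hA hp (AddSubmonoid.subset_closure ha) hr⟩, rfl⟩
    · rintro _ ⟨a, ha, rfl⟩
      exact ⟨toR_mem_cone ha, a, ha.1, rfl⟩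

theorem exists_nsmul_sub_mem_of_mem_NSemi_faceOf {p g : Fin d → ℤ} (hg : g ∈ NSemi (faceOf A p)) :
    ∃ N : ℕ, N • p - g ∈ NSemi A := by
  induction hg using AddSubmonoid.closure_induction with
  | mem x hx => exact hx.2
  | zero => exact ⟨0, by simp⟩
  | add x y _ _ hx hy =>
    obtain ⟨N, hN⟩ := hx
    obtain ⟨M, hM⟩ := hy
    refine ⟨N + M, ?_⟩
    convert add_mem hN hM using 1
    rw [add_smul]
    abel

theorem NSemi_mono (h : F ⊆ A) : NSemi F ≤ NSemi A := AddSubmonoid.closure_mono h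

theorem eq_zero_of_add_eq_zero_of_mem_NSemi (hA : IsConfig A) {v w : Fin d → ℤ} (hv : v ∈ NSemi A)
    (hw : w ∈ NSemi A) (h : v + w = 0) : v = 0 := by
  have hneg : -toR v = toR w := by
    rw [eq_neg_of_add_eq_zero_right h]
    funext i
    simp [toR]
  have h0 := hA.pointed _ (toR_mem_cone_of_mem_NSemi hA.finite hv)
    (hneg ▸ toR_mem_cone_of_mem_NSemi hA.finite hw)
  exact toR_injective (h0.trans (toRHom d).map_zero.symm)

end Cone

/-- A monotone sequence of natural numbers is eventually constant or tends to infinity. -/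
theorem eventually_const_or_tendsto_atTop_of_monotone {u : ℕ → ℕ} (hu : Monotone u) :
    (∃ l, ∀ᶠ k in Filter.atTop, u k = l) ∨ Filter.Tendsto u Filter.atTop Filter.atTop := by
  rcases tendsto_atTop_of_monotone hu with h | ⟨l, h⟩
  · exact Or.inr h
  · rw [nhds_discrete, Filter.tendsto_pure] at h
    exact Or.inl ⟨l, h⟩

theorem finite_setOf_stdPair {d : ℕ} {A E : Set (Fin d → ℤ)} (hA : IsConfig A)
    (hE : IsExpSet A E) (F : Set (Fin d → ℤ)) : {a | StdPair A E a F}.Finite := by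
  classical
  by_contra hinf
  let a : ℕ ↪ {a | StdPair A E a F} := Set.Infinite.natEmbedding _ hinf
  have ha : ∀ k, StdPair A E (a k) F := fun k => (a k).2
  have hFA : F ⊆ A := (ha 0).1.2.1.1
  let I := hA.finite.toFinset
  have hI : ∀ i : I, (i : Fin d → ℤ) ∈ A := fun i => hA.finite.mem_toFinset.1 i.2
  have hrep : ∀ k, ∃ u : I → ℕ, ∑ i, u i • (i : Fin d → ℤ) = a k := by
    intro k
    have h : (a k : Fin d → ℤ) ∈ AddSubmonoid.closure (Set.range fun i : I => (i : Fin d → ℤ)) := by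
      convert (ha k).1.1 using 2
      simp [I, NSemi]
    obtain ⟨u, hu⟩ := AddSubmonoid.mem_closure_range_iff_of_fintype.1 h
    exact ⟨u, hu.symm⟩
  choose u hu using hrep
  obtain ⟨σ, hσ⟩ := (wellQuasiOrdered_le (α := I → ℕ)).exists_monotone_subseq u
  have hmono : ∀ {m n}, m ≤ n → ∀ i, u (σ m) i ≤ u (σ n) i := fun h => hσ _ _ h
  let S : Finset I := Finset.univ.filter fun i =>
    Filter.Tendsto (fun k => u (σ k) i) Filter.atTop Filter.atTop
  have hconst : ∀ i : I, ∃ l, i ∉ S → ∀ᶠ k in Filter.atTop, u (σ k) i = l := by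
    intro i
    rcases eventually_const_or_tendsto_atTop_of_monotone
      (u := fun k => u (σ k) i) (fun m n h => hmono h i) with ⟨l, hl⟩ | h
    · exact ⟨l, fun _ => hl⟩
    · exact ⟨0, fun hi => absurd (by simpa [S] using h) hi⟩
  choose l hl using hconst
  obtain ⟨m, hm⟩ : ∃ m, ∀ k ≥ m, ∀ i, i ∉ S → u (σ k) i = l i :=
    Filter.eventually_atTop.1 (Filter.eventually_all.2 fun i => by
      by_cases hi : i ∈ S
      · exact Filter.Eventually.of_forall fun k h => absurd hi h
      · exact (hl i hi).mono fun k h _ => h)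
  have hstep : ∀ k ≥ m, (a (σ k) : Fin d → ℤ)
      = a (σ m) + ∑ i ∈ S, (u (σ k) i - u (σ m) i) • (i : Fin d → ℤ) := by
    intro k hk
    rw [← hu, ← hu, Finset.sum_subset (Finset.subset_univ S), ← Finset.sum_add_distrib]
    · refine Finset.sum_congr rfl fun i _ => ?_
      rw [← add_smul, Nat.add_sub_cancel' (hmono hk i)]
    · intro i _ hi
      rw [hm k hk i hi, hm m le_rfl i hi, Nat.sub_self, zero_smul]
  have hF : F.Finite := hA.finite.subset hFA
  let q : Fin d → ℤ := ∑ v ∈ hF.toFinset, v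
  let p : Fin d → ℤ := ∑ i ∈ S, (i : Fin d → ℤ) + q
  have hsubset : ∀ {v}, v ∈ A → v ∈ NSemi A := fun h => AddSubmonoid.subset_closure h
  have hqF : q ∈ NSemi F := sum_mem fun v hv =>
    AddSubmonoid.subset_closure (hF.mem_toFinset.1 hv)
  have hq : q ∈ NSemi A := NSemi_mono hFA hqF
  have hS : ∑ i ∈ S, (i : Fin d → ℤ) ∈ NSemi A := sum_mem fun i _ => hsubset (hI i)
  have hp : p ∈ NSemi A := add_mem hS hq
  have hFG : F ⊆ faceOf A p := by
    intro v hv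
    refine ⟨hFA hv, 1, ?_⟩
    have : 1 • p - v = ∑ i ∈ S, (i : Fin d → ℤ) + ∑ w ∈ hF.toFinset.erase v, w := by
      simp only [p, q]
      rw [← Finset.add_sum_erase _ (fun w => w) (hF.mem_toFinset.2 hv)]
      abel
    rw [this]
    exact add_mem hS (sum_mem fun w hw =>
      hsubset (hFA (hF.mem_toFinset.1 (Finset.mem_of_mem_erase hw))))
  have hSG : ∀ i ∈ S, (i : Fin d → ℤ) ∈ faceOf A p := by
    intro i hi
    refine ⟨hI i, 1, ?_⟩
    have : 1 • p - (i : Fin d → ℤ) = ∑ j ∈ S.erase i, (j : Fin d → ℤ) + q := by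
      simp only [p]
      rw [← Finset.add_sum_erase _ (fun j : I => (j : Fin d → ℤ)) hi]
      abel
    rw [this]
    exact add_mem (sum_mem fun j _ => hsubset (hI j)) hq
  have hproper : ProperPair A E (a (σ m)) (faceOf A p) := by
    refine ⟨(ha _).1.1, isFace_faceOf hA.finite hp, ?_⟩
    rintro _ ⟨g, hg, rfl⟩
    refine ⟨add_mem (ha _).1.1 (NSemi_mono (faceOf_subset A p) hg), fun hmem => ?_⟩
    obtain ⟨N, hN⟩ := exists_nsmul_sub_mem_of_mem_NSemi_faceOf hg
    obtain ⟨k, hkm, hk⟩ : ∃ k ≥ m, ∀ i ∈ S, N + u (σ m) i ≤ u (σ k) i := by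
      have : ∀ᶠ k in Filter.atTop, ∀ i, i ∈ S → N + u (σ m) i ≤ u (σ k) i :=
        Filter.eventually_all.2 fun i => by
          by_cases hi : i ∈ S
          · exact ((Finset.mem_filter.1 hi).2.eventually_ge_atTop _).mono fun k h _ => h
          · exact Filter.Eventually.of_forall fun k h => absurd h hi
      obtain ⟨k, hk⟩ := ((Filter.eventually_ge_atTop m).and this).exists
      exact ⟨k, hk.1, hk.2⟩
    refine ((ha (σ k)).1.2.2 ⟨N • q, nsmul_mem hqF N, rfl⟩).2 ?_
    have hsum : ∑ i ∈ S, (u (σ k) i - u (σ m) i) • (i : Fin d → ℤ)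
        = N • ∑ i ∈ S, (i : Fin d → ℤ)
          + ∑ i ∈ S, (u (σ k) i - u (σ m) i - N) • (i : Fin d → ℤ) := by
      rw [Finset.smul_sum, ← Finset.sum_add_distrib]
      refine Finset.sum_congr rfl fun i hi => ?_
      have := hk i hi
      rw [← add_smul]
      congr 1
      omega
    have : (a (σ k) : Fin d → ℤ) + N • q = a (σ m) + g + ((N • p - g)
        + ∑ i ∈ S, (u (σ k) i - u (σ m) i - N) • (i : Fin d → ℤ)) := by
      rw [hstep k hkm, hsum]
      simp only [p, smul_add]
      abel
    rw [this]
    exact hE.2 _ hmem _ (add_mem hN (sum_mem fun i _ => nsmul_mem (hsubset (hI i)) _))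
  have hGF : ∀ g ∈ NSemi (faceOf A p), g ∈ NSemi F := by
    intro g hg
    obtain ⟨f, hf, hgf⟩ := (ha (σ m)).2 _ _ hproper
      (by rintro _ ⟨f, hf, rfl⟩; exact ⟨f, NSemi_mono hFG hf, rfl⟩) ⟨g, hg, rfl⟩
    rwa [add_left_cancel hgf]
  set w := ∑ i ∈ S, (u (σ (m + 1)) i - u (σ m) i) • (i : Fin d → ℤ) with hw
  have hwF : w ∈ NSemi F :=
    hGF _ (sum_mem fun i hi => nsmul_mem (AddSubmonoid.subset_closure (hSG i hi)) _)
  have heq := hstep (m + 1) (Nat.le_succ m)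
  rw [← hw] at heq
  obtain ⟨f, hf, hwf⟩ := (ha (σ (m + 1))).2 _ _ (ha (σ m)).1
    (by rintro _ ⟨f, hf, rfl⟩; exact ⟨w + f, add_mem hwF hf, by rw [heq, add_assoc]⟩)
    ⟨0, zero_mem _, rfl⟩
  have hw0 : w = 0 := by
    refine eq_zero_of_add_eq_zero_of_mem_NSemi hA (NSemi_mono hFA hwF) (NSemi_mono hFA hf) ?_
    rw [heq, add_assoc] at hwf
    exact (add_left_cancel hwf).symm
  rw [hw0, add_zero] at heq
  have := σ.injective (a.injective (Subtype.ext heq))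
  omega

/-- A monomial ideal (exponent set `E`) has only finitely many
standard pairs. -/
theorem finitely_many_stdPairs {d : ℕ} (A : Set (Fin d → ℤ)) (hA : IsConfig A)
    (E : Set (Fin d → ℤ)) (hE : IsExpSet A E) :
    {p : (Fin d → ℤ) × Set (Fin d → ℤ) | StdPair A E p.1 p.2}.Finite := by
  have hfin : (⋃ F ∈ 𝒫 A, (fun a => (a, F)) '' {a | StdPair A E a F}).Finite :=
    hA.finite.finite_subsets.biUnion fun F _ => (finite_setOf_stdPair hA hE F).image _
  refine hfin.subset fun p hp => ?_
  simp only [Set.mem_iUnion]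
  exact ⟨p.2, hp.1.2.1.1, p.1, hp, rfl⟩

end StdPairsPaper
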